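/- Let n be a positive integer and let A be an AW*-algebra of type I_n, and let M be a maximal abelian subalgebra of A. Then M contains n pairwise orthogonal, pairwise equivalent projections e₁, …, e_n, each abelian in A and each with central cover 1, such that e₁ + ⋯ + e_n = 1. -/

import Mathlib

universe u

section Defs

variable {R : Type u} [Ring R] [StarRing R]

/-- An element is a projection if it is self-adjoint and idempotent. -/
def IsProjection (p : R) : Prop := star p = p ∧ p * p = p

/-- Order on projections: `e ≤ f` iff `e = ef`. -/
def ProjLE (e f : R) : Prop := e * f = e

/-- Murray–von Neumann equivalence of projections. -/
def ProjEquiv (e f : R) : Prop := ∃ v : R, star v * v = e ∧ v * star v = f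

/-- `e ≼ f` : `e` is equivalent to a subprojection of `f`. -/
def ProjSubEquiv (e f : R) : Prop :=
  ∃ e' : R, IsProjection e' ∧ ProjLE e' f ∧ ProjEquiv e e'

/-- `e ≺ f` : `e ≼ f` but `e` is not equivalent to `f` (with the convention `0 ≺ 0`). -/
def ProjLT (e f : R) : Prop :=
  (ProjSubEquiv e f ∧ ¬ ProjEquiv e f) ∨ (e = 0 ∧ f = 0)

/-- A central projection. -/
def IsCentralProj (z : R) : Prop := IsProjection z ∧ ∀ a : R, z * a = a * z

/-- `c` is the central cover of `e`: the least central projection above `e`. -/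
def IsCentralCover (e c : R) : Prop :=
  IsCentralProj c ∧ ProjLE e c ∧
    ∀ z : R, IsCentralProj z → ProjLE e z → ProjLE c z

/-- A projection `e` is finite if `e ∼ f ≤ e` implies `f = e`. -/
def ProjFinite (e : R) : Prop :=
  ∀ f : R, IsProjection f → ProjEquiv e f → ProjLE f e → f = e

/-- A nonzero projection is properly infinite if `ze` is infinite
for every central projection `z` with `ze ≠ 0`. -/
def ProperlyInfinite (e : R) : Prop :=
  IsProjection e ∧ e ≠ 0 ∧
    ∀ z : R, IsCentralProj z → z * e ≠ 0 → ¬ ProjFinite (z * e)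

/-- A pairwise orthogonal family of elements. -/
def PairwiseOrthogonal {ι : Type*} (p : ι → R) : Prop :=
  ∀ i j, i ≠ j → p i * p j = 0

/-- `s` is the supremum of the family `p` in the projection order. For an
orthogonal family, this is the sum `Σ pᵢ`. -/
def IsSupProj {ι : Type*} (p : ι → R) (s : R) : Prop :=
  IsProjection s ∧ (∀ i, ProjLE (p i) s) ∧
    ∀ t : R, IsProjection t → (∀ i, ProjLE (p i) t) → ProjLE s t

/-- The family `p` belongs to `Γ(e)`: an orthogonal family of projections,
each equivalent to `e`, with sum (supremum) `e`. -/
def InGamma (e : R) {ι : Type u} (p : ι → R) : Prop :=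
  (∀ i, IsProjection (p i)) ∧ PairwiseOrthogonal p ∧
    (∀ i, ProjEquiv (p i) e) ∧ IsSupProj p e

open Classical in
/-- The dimension `d(e)` of a properly infinite projection: the least cardinal
strictly greater than the cardinality of the index set of every family in
`Γ(e)`, with the convention `d(0) = 0`. -/
noncomputable def projDim (e : R) : Cardinal.{u} :=
  if e = 0 then 0
  else sSup {c : Cardinal.{u} |
    ∃ (ι : Type u) (p : ι → R), InGamma e p ∧ c = Order.succ (Cardinal.mk ι)}

/-- A properly infinite projection `e` is equidimensional if `d(ze) = d(e)`
for every central projection `z` with `ze ≠ 0` (equivalently, for every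
nonzero central projection `z ≤ c(e)`). -/
def Equidimensional (e : R) : Prop :=
  ProperlyInfinite e ∧
    ∀ z : R, IsCentralProj z → z * e ≠ 0 → projDim (z * e) = projDim e

/-- An abelian projection: the corner `eRe` is commutative. -/
def IsAbelianProj (e : R) : Prop :=
  IsProjection e ∧ ∀ a b : R, (e * a * e) * (e * b * e) = (e * b * e) * (e * a * e)

/-- `j` is the join `e ∨ f` in the projection lattice. -/
def IsJoinProj (e f j : R) : Prop :=
  IsProjection j ∧ ProjLE e j ∧ ProjLE f j ∧
    ∀ t : R, IsProjection t → ProjLE e t → ProjLE f t → ProjLE j t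

end Defs

/-- The AW*-condition: the right annihilator of any subset is generated by a
projection: `{a | ∀ s ∈ S, s a = 0} = pR`. -/
def IsAWStarRing (R : Type*) [Ring R] [StarRing R] : Prop :=
  ∀ S : Set R, ∃ p : R, IsProjection p ∧
    {a : R | ∀ s ∈ S, s * a = 0} = {a : R | ∃ b : R, a = p * b}

/-- A maximal abelian (*-sub)algebra. -/
def IsMaximalAbelian {A : Type*} [Ring A] [StarRing A] [Algebra ℂ A] [StarModule ℂ A]
    (M : StarSubalgebra ℂ A) : Prop :=
  (∀ x ∈ M, ∀ y ∈ M, x * y = y * x) ∧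
    ∀ N : StarSubalgebra ℂ A, (∀ x ∈ N, ∀ y ∈ N, x * y = y * x) → M ≤ N → M = N


structure AWModel (A : Type u) [CStarAlgebra A] (n : ℕ) where
  X : Type u
  top : TopologicalSpace X
  π : X → A →⋆ₐ[ℂ] Matrix (Fin n) (Fin n) ℂ
  E : Fin n → Fin n → A
  inj : ∀ a, (∀ x, π x a = 0) → a = 0
  lift : ∀ c : C(X, ℂ), ∃ z : A, (∀ a, z * a = a * z) ∧ ∀ x, π x z = c x • 1
  cont : ∀ a i j, Continuous fun x => π x a i j
  cont' : ∀ x i j, Continuous fun a => π x a i j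
  units : ∀ i j x, π x (E i j) = Matrix.single i j 1

theorem matUnits_exist {A : Type u} [CStarAlgebra A] (n : ℕ) (i0 : Fin n)
    (f : Fin n → A) (hab : ∀ i, IsAbelianProj (f i)) (horth : PairwiseOrthogonal f)
    (heq : ∀ i j, ProjEquiv (f i) (f j)) (hsum : ∑ i, f i = 1) :
    ∃ E : Fin n → Fin n → A, (∀ i j, star (E i j) = E j i) ∧
      (∀ i j k, E i j * E j k = E i k) ∧ (∀ i j k l, j ≠ k → E i j * E k l = 0) ∧
      (∑ i, E i i = 1) ∧
      (∀ a b, (E i0 i0 * a * E i0 i0) * (E i0 i0 * b * E i0 i0)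
        = (E i0 i0 * b * E i0 i0) * (E i0 i0 * a * E i0 i0)) := by
  choose v hv1 hv2 using fun i => heq i0 i
  have hp : ∀ i, f i * f i = f i := fun i => (hab i).1.2
  have hs : ∀ i, star (f i) = f i := fun i => (hab i).1.1
  have hvf : ∀ i, v i * f i0 = v i := by
    intro i
    have h : star (v i * f i0 - v i) * (v i * f i0 - v i) = 0 := by
      have : star (v i * f i0 - v i) * (v i * f i0 - v i) =
        f i0 * (star (v i) * v i) * f i0 - f i0 * (star (v i) * v i)
          - (star (v i) * v i) * f i0 + star (v i) * v i := by
        rw [star_sub, star_mul, hs]; noncomm_ring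
      rw [this, hv1]; simp [hp]
    exact sub_eq_zero.1 ((CStarRing.star_mul_self_eq_zero_iff _).1 h)
  have hfv : ∀ i, f i * v i = v i := by
    intro i
    rw [← hv2 i, mul_assoc, hv1, hvf]
  have hvv : ∀ i j, i ≠ j → star (v i) * v j = 0 := by
    intro i j hij
    rw [← hfv i, ← hfv j, star_mul, hs, mul_assoc, ← mul_assoc (f i), horth i j hij]; simp
  have hdiag : ∀ i, v i * star (v i) = f i := hv2
  refine ⟨fun i j => v i * star (v j), ?_, ?_, ?_, ?_, ?_⟩
  · intro i j; simp
  · intro i j k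
    rw [mul_assoc, ← mul_assoc (star (v j)), hv1, ← mul_assoc, hvf]
  · intro i j k l h
    rw [mul_assoc, ← mul_assoc (star (v j)), hvv j k h]; simp
  · simp only [hdiag]; exact hsum
  · intro a b
    simp only [hdiag]; exact (hab i0).2 a b

theorem exists_awModel {A : Type u} [CStarAlgebra A] (n : ℕ) (i0 : Fin n)
    (f : Fin n → A) (hab : ∀ i, IsAbelianProj (f i)) (horth : PairwiseOrthogonal f)
    (heq : ∀ i j, ProjEquiv (f i) (f j)) (hsum : ∑ i, f i = 1) :
    Nonempty (AWModel A n) := by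
  obtain ⟨E, hst, hmul, hz, hone, hcomm⟩ := matUnits_exist n i0 f hab horth heq hsum
  set T : Fin n → Fin n → A → A := fun i j a => ∑ k, E k i * a * E j k with hT
  have hTl : ∀ i j a p q, E p q * T i j a = E p i * a * E j q := by
    intro i j a p q
    simp only [hT, Finset.mul_sum]
    rw [Finset.sum_eq_single q]
    · rw [← mul_assoc, ← mul_assoc, hmul]
    · intro b _ hb; rw [← mul_assoc, ← mul_assoc, hz _ _ _ _ hb.symm]; simp
    · simp
  have hTr : ∀ i j a p q, T i j a * E p q = E p i * a * E j q := by
    intro i j a p q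
    simp only [hT, Finset.sum_mul]
    rw [Finset.sum_eq_single p]
    · rw [mul_assoc, hmul]
    · intro b _ hb; rw [mul_assoc, hz _ _ _ _ hb]; simp
    · simp
  have hcen0 : ∀ i j a b, T i j a * (E i0 i0 * b * E i0 i0) = (E i0 i0 * b * E i0 i0) * T i j a := by
    intro i j a b
    have h := hcomm (E i0 i * a * E j i0) b
    have h1 : E i0 i0 * (E i0 i * a * E j i0) * E i0 i0 = E i0 i * a * E j i0 := by
      rw [← mul_assoc, ← mul_assoc, hmul, mul_assoc, hmul]
    rw [h1] at h
    rw [mul_assoc (E i0 i0 * b), hTl, ← mul_assoc, ← mul_assoc, hTr]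
    calc _ = E i0 i * a * E j i0 * (E i0 i0 * b * E i0 i0) := by
            simp only [← mul_assoc]; rw [mul_assoc (E i0 i * a) (E j i0) (E i0 i0), hmul]
      _ = _ := h
      _ = _ := by
            rw [mul_assoc (E i0 i0 * b), ← mul_assoc (E i0 i0), ← mul_assoc (E i0 i0), hmul]
  have hdec : ∀ c : A, c = ∑ p, ∑ q, E p i0 * (E i0 i0 * (E i0 p * c * E q i0) * E i0 i0) * E i0 q := by
    intro c
    have : ∀ p q, E p i0 * (E i0 i0 * (E i0 p * c * E q i0) * E i0 i0) * E i0 q = E p p * c * E q q := by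
      intro p q
      simp only [← mul_assoc, hmul]
      simp only [mul_assoc, hmul]
    simp only [this, ← Finset.mul_sum, hone, mul_one, ← Finset.sum_mul, one_mul]
  have hcen : ∀ i j a c, T i j a * c = c * T i j a := by
    intro i j a c
    rw [hdec c]
    simp only [Finset.mul_sum, Finset.sum_mul]
    refine Finset.sum_congr rfl fun p _ => Finset.sum_congr rfl fun q _ => ?_
    have hE : ∀ p q, Commute (T i j a) (E p q) := fun p q => by
      rw [Commute, SemiconjBy, hTl, hTr]
    exact (((hE p i0).mul_right (hcen0 i j a _)).mul_right (hE i0 q)).eq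
  let Z : StarSubalgebra ℂ A := StarSubalgebra.centralizer ℂ Set.univ
  have hmemZ : ∀ z : A, (∀ a, z * a = a * z) → z ∈ Z := by
    intro z h
    rw [StarSubalgebra.mem_centralizer_iff]
    exact fun g _ => ⟨(h g).symm, (h _).symm⟩
  have hZ : ∀ z ∈ Z, ∀ a, z * a = a * z := by
    intro z h a
    rw [StarSubalgebra.mem_centralizer_iff] at h
    exact ((h a trivial).1).symm
  have hclosed : IsClosed (Z : Set A) := by
    rw [StarSubalgebra.coe_centralizer]
    exact Set.isClosed_centralizer _
  let iC : CStarAlgebra Z := StarSubalgebra.cstarAlgebra Z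
  let _ : CommCStarAlgebra Z := { iC with mul_comm := fun a b => Subtype.ext (hZ a a.2 b) }
  let G := gelfandStarTransform Z
  let t : Fin n → Fin n → A → Z := fun i j a => ⟨T i j a, hmemZ _ (hcen i j a)⟩
  have t_mul : ∀ i j a b, t i j (a * b) = ∑ l, t i l a * t l j b := by
    intro i j a b
    apply Subtype.ext
    rw [AddSubmonoidClass.coe_finsetSum]
    change T i j (a * b) = ∑ l, T i l a * T l j b
    have : ∀ l, T i l a * T l j b = ∑ k, E k i * a * E l l * b * E j k := by
      intro l
      rw [hT]
      simp only [Finset.sum_mul]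
      refine Finset.sum_congr rfl fun k _ => ?_
      rw [mul_assoc _ (E l k)]
      have := hTl l j b l k
      simp only [hT] at this
      rw [this]; simp only [mul_assoc]
    simp only [this]
    rw [Finset.sum_comm]
    refine Finset.sum_congr rfl fun k _ => ?_
    simp only [← Finset.sum_mul, ← Finset.mul_sum, hone, one_mul, mul_assoc]
  have t_central : ∀ i j a, (∀ b, a * b = b * a) → T i j a = if i = j then a else 0 := by
    intro i j a ha
    have : ∀ k, E k i * a * E j k = a * (E k i * E j k) := fun k => by rw [← ha, mul_assoc]
    simp only [hT, this, ← Finset.mul_sum]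
    split_ifs with h
    · subst h; simp [hmul, hone]
    · simp [hz _ _ _ _ h]
  have t_star : ∀ i j a, t i j (star a) = star (t j i a) := by
    intro i j a
    apply Subtype.ext
    change T i j (star a) = star (T j i a)
    simp [hT, star_sum, hst, mul_assoc]
  have t_add : ∀ i j a b, t i j (a + b) = t i j a + t i j b := by
    intro i j a b
    apply Subtype.ext
    change T i j (a + b) = T i j a + T i j b
    simp [hT, mul_add, add_mul, Finset.sum_add_distrib]
  have t_c : ∀ i j (c : ℂ), t i j (algebraMap ℂ A c) = if i = j then algebraMap ℂ Z c else 0 := by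
    intro i j c
    apply Subtype.ext
    have := t_central i j (algebraMap ℂ A c) (fun b => Algebra.commutes c b)
    change T i j _ = _
    rw [this]; split_ifs <;> rfl
  have t_E : ∀ i j p q, t i j (E p q) = if i = p ∧ j = q then 1 else 0 := by
    intro i j p q
    apply Subtype.ext
    change T i j (E p q) = _
    simp only [hT]
    split_ifs with h
    · obtain ⟨rfl, rfl⟩ := h
      simp [hmul, hone]
    · apply Finset.sum_eq_zero
      intro k _
      by_cases hp : i = p
      · subst hp
        have hq : q ≠ j := fun h' => h ⟨rfl, h'.symm⟩
        rw [mul_assoc, hz _ _ _ _ hq, mul_zero]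
      · rw [hz _ _ _ _ hp, zero_mul]
  let π : WeakDual.characterSpace ℂ Z → A →⋆ₐ[ℂ] Matrix (Fin n) (Fin n) ℂ := fun x =>
    { toFun := fun a => Matrix.of fun i j => G (t i j a) x
      map_mul' := by
        intro a b; ext i j
        simp [t_mul, Matrix.mul_apply, map_sum, ContinuousMap.sum_apply]
      map_one' := by
        ext i j
        have := t_c i j 1
        simp only [map_one] at this
        simp only [Matrix.of_apply, this, Matrix.one_apply]
        split_ifs <;> simp
      map_zero' := by
        ext i j
        have := t_c i j 0
        simp only [map_zero, ite_self] at this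
        simp [this]
      map_add' := by
        intro a b; ext i j
        simp [t_add]
      commutes' := by
        intro c
        ext i j
        simp only [Matrix.of_apply, t_c, Matrix.algebraMap_matrix_apply]
        split_ifs <;> simp [AlgHomClass.commutes]
      map_star' := by
        intro a; ext i j
        simp only [Matrix.of_apply, t_star, Matrix.star_apply, map_star]
        rfl }
  refine ⟨⟨_, inferInstance, π, E, ?_, ?_, ?_, ?_, ?_⟩⟩
  · intro a h
    have h0 : ∀ i j, T i j a = 0 := by
      intro i j
      have : t i j a = 0 := by
        apply G.injective
        rw [map_zero]
        ext x
        exact congrFun (congrFun (h x) i) j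
      exact congrArg Subtype.val this
    have : a = ∑ i, ∑ j, E i i * T i j a * E i j := by
      have : ∀ i j, E i i * T i j a * E i j = E i i * a * E j j := by
        intro i j
        rw [hTl, mul_assoc, hmul]
      simp only [this, ← Finset.mul_sum, hone, mul_one, ← Finset.sum_mul, one_mul]
    rw [this]
    simp [h0]
  · intro c
    refine ⟨(G.symm c : Z), hZ _ (G.symm c).2, fun x => ?_⟩
    ext i j
    change G (t i j _) x = _
    have h1 : t i j (G.symm c : Z) = if i = j then G.symm c else 0 := by
      apply Subtype.ext
      change T i j _ = _
      rw [t_central i j _ (hZ _ (G.symm c).2)]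
      split_ifs <;> rfl
    rw [h1]
    simp only [Matrix.smul_apply, Matrix.one_apply]
    split_ifs <;> simp
  · intro a i j
    exact (G (t i j a)).continuous
  · intro x i j
    have : Continuous (t i j) := by
      apply Continuous.subtype_mk
      simp only [hT]
      fun_prop
    exact (map_continuous x).comp this
  · intro p q x
    ext i j
    change G (t i j _) x = _
    rw [t_E, Matrix.single_apply]
    simp only [eq_comm]
    split_ifs <;> simp

attribute [instance] AWModel.top

theorem awsup {A : Type u} [CStarAlgebra A] (hAW : IsAWStarRing A) (S N : Set A)
    (hN : ∀ m ∈ N, star m ∈ N) (hSN : ∀ s ∈ S, ∀ m ∈ N, s * m = m * s) :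
    ∃ e : A, IsProjection e ∧ (∀ s ∈ S, s * e = s) ∧
      (∀ a, (∀ s ∈ S, s * a = 0) → e * a = 0) ∧ ∀ m ∈ N, e * m = m * e := by
  obtain ⟨p, ⟨hps, hpp⟩, h⟩ := hAW S
  have hsp : ∀ s ∈ S, s * p = 0 := by
    have : p ∈ {a : A | ∀ s ∈ S, s * a = 0} := by
      rw [h]; exact ⟨1, by simp⟩
    exact this
  have han : ∀ a, (∀ s ∈ S, s * a = 0) → (1 - p) * a = 0 := by
    intro a ha
    have : a ∈ {a : A | ∃ b : A, a = p * b} := by rw [← h]; exact ha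
    obtain ⟨b, rfl⟩ := this
    rw [← mul_assoc, sub_mul, hpp]; simp
  have h1 : ∀ m ∈ N, (1 - p) * m * p = 0 := by
    intro m hm
    rw [mul_assoc]
    apply han
    intro s hs
    rw [← mul_assoc, hSN s hs m hm, mul_assoc, hsp s hs, mul_zero]
  refine ⟨1 - p, ⟨by simp [hps], by simp [mul_sub, sub_mul, hpp]⟩, ?_, han, ?_⟩
  · intro s hs; simp [mul_sub, hsp s hs]
  · intro m hm
    have h2 := h1 m hm
    have h3 := congrArg star (h1 _ (hN m hm))
    simp only [star_mul, star_sub, star_one, hps, star_star, star_zero] at h3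
    have e1 : m * p = p * m * p := by
      rw [sub_mul, sub_mul, one_mul, sub_eq_zero] at h2; exact h2
    have e2 : p * m = p * m * p := by
      rw [mul_sub, mul_sub, mul_one, sub_eq_zero, ← mul_assoc] at h3; exact h3
    rw [sub_mul, mul_sub, one_mul, mul_one, e1, e2]
    rw [mul_assoc (p * m), hpp]

theorem masa_mem {A : Type u} [CStarAlgebra A] (M : StarSubalgebra ℂ A) (hM : IsMaximalAbelian M)
    (x : A) (hx : ∀ m ∈ M, x * m = m * x) : x ∈ M := by
  have key : ∀ y : A, star y = y → (∀ m ∈ M, y * m = m * y) → y ∈ M := by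
    intro y hy hc
    let S : Set A := insert y (M : Set A)
    have hSs : ∀ a ∈ S, star a ∈ S := by
      rintro a (rfl | ha)
      · left; exact hy
      · right; exact star_mem ha
    have hSc : ∀ a ∈ S, ∀ b ∈ S, a * b = b * a := by
      rintro a (rfl | ha) b (rfl | hb)
      · rfl
      · exact hc b hb
      · exact (hc a ha).symm
      · exact hM.1 a ha b hb
    let N := StarSubalgebra.centralizer ℂ (StarSubalgebra.centralizer ℂ S : Set A)
    have hSN : S ⊆ N := by
      intro a ha
      change a ∈ N
      rw [StarSubalgebra.mem_centralizer_iff]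
      intro g hg
      have hg' : g ∈ StarSubalgebra.centralizer ℂ S := hg
      have hg2 : star g ∈ StarSubalgebra.centralizer ℂ S := star_mem hg'
      rw [StarSubalgebra.mem_centralizer_iff] at hg' hg2
      exact ⟨(hg' a ha).1.symm, (hg2 a ha).1.symm⟩
    have hSC : S ⊆ StarSubalgebra.centralizer ℂ S := by
      intro a ha
      change a ∈ StarSubalgebra.centralizer ℂ S
      rw [StarSubalgebra.mem_centralizer_iff]
      exact fun g hg => ⟨hSc g hg a ha, hSc _ (hSs g hg) a ha⟩
    have hNC : ∀ b ∈ N, b ∈ StarSubalgebra.centralizer ℂ S := by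
      intro b hb
      rw [StarSubalgebra.mem_centralizer_iff] at hb ⊢
      exact fun g hg => hb g (hSC hg)
    have := hM.2 N (by
      intro a ha b hb
      have hb' := hNC b hb
      rw [StarSubalgebra.mem_centralizer_iff] at ha
      exact ((ha b hb').1).symm) (fun a ha => hSN (Or.inr ha))
    rw [this]
    exact hSN (Or.inl rfl)
  have hxs : ∀ m ∈ M, star x * m = m * star x := by
    intro m hm
    have := congrArg star (hx _ (star_mem hm))
    simpa using this.symm
  have h1 : (realPart x : A) ∈ M := by
    apply key _ (realPart x).2
    intro m hm
    rw [realPart_apply_coe]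
    simp [add_mul, mul_add, hx m hm, hxs m hm]
  have h2 : (imaginaryPart x : A) ∈ M := by
    apply key _ (imaginaryPart x).2
    intro m hm
    rw [imaginaryPart_apply_coe]
    simp [sub_mul, mul_sub, hx m hm, hxs m hm]
  rw [← realPart_add_I_smul_imaginaryPart x]
  exact add_mem h1 (M.smul_mem h2 _)

theorem mat_trace_eq_rank {n : ℕ} (P : Matrix (Fin n) (Fin n) ℂ) (h : P * P = P) :
    P.trace = (P.rank : ℂ) := by
  have h1 : IsIdempotentElem (Matrix.toLin' P) := by
    rw [IsIdempotentElem, Module.End.mul_eq_comp, ← Matrix.toLin'_mul, h]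
  have := (LinearMap.IsIdempotentElem.isProj_range _ h1).trace
  rw [Matrix.trace_toLin'_eq] at this
  rw [this]; rfl

namespace AWModel

variable {A : Type u} [CStarAlgebra A] {n : ℕ} (m : AWModel A n)

theorem ext' {a b : A} (h : ∀ x, m.π x a = m.π x b) : a = b := by
  rw [← sub_eq_zero]; apply m.inj; intro x; rw [map_sub, h, sub_self]

noncomputable def rk (a : A) (x : m.X) : ℕ := (m.π x a).rank

theorem proj_sq {p : A} (hp : IsProjection p) (x : m.X) : m.π x p * m.π x p = m.π x p := by
  rw [← map_mul, hp.2]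

theorem rk_trace {p : A} (hp : IsProjection p) (x : m.X) :
    (m.π x p).trace = (m.rk p x : ℂ) := mat_trace_eq_rank _ (m.proj_sq hp x)

theorem rk_cont {p : A} (hp : IsProjection p) : Continuous (m.rk p) := by
  rw [Nat.isClosedEmbedding_coe_real.isInducing.continuous_iff]
  have h1 : Continuous fun x => ((m.π x p).trace).re := by
    apply Complex.continuous_re.comp
    simp only [Matrix.trace, Matrix.diag]
    exact continuous_finsetSum _ fun i _ => m.cont p i i
  convert h1 using 2 with x
  simp [m.rk_trace hp]

theorem rk_zero {p : A} (hp : IsProjection p) (x : m.X) : m.rk p x = 0 ↔ m.π x p = 0 := by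
  constructor
  · intro h
    have h2 : LinearMap.range (Matrix.toLin' (m.π x p)) = ⊥ := by
      apply Submodule.finrank_eq_zero.1
      exact h
    rw [LinearMap.range_eq_bot] at h2
    simpa using h2
  · intro h; simp [rk, h]

theorem rk_sub {g h : A} (hg : IsProjection g) (hh : IsProjection h) (hle : h * g = h) (x : m.X) :
    IsProjection (g - h) ∧ m.rk (g - h) x + m.rk h x = m.rk g x := by
  have hle' : g * h = h := by
    have := congrArg star hle
    simpa [hg.1, hh.1] using this
  have hp : IsProjection (g - h) := by
    refine ⟨by simp [hg.1, hh.1], ?_⟩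
    simp [mul_sub, sub_mul, hg.2, hh.2, hle, hle']
  refine ⟨hp, ?_⟩
  have := m.rk_trace hp x
  rw [map_sub, Matrix.trace_sub, m.rk_trace hg, m.rk_trace hh] at this
  have h2 : (m.rk g x : ℂ) = m.rk (g - h) x + m.rk h x := by rw [← this]; ring
  exact_mod_cast h2.symm

theorem ind {U : Set m.X} (hU : IsClopen U) : ∃ z : A, IsCentralProj z ∧
    (∀ x ∈ U, m.π x z = 1) ∧ ∀ x ∉ U, m.π x z = 0 := by
  obtain ⟨z, hz, hzx⟩ := m.lift ⟨U.indicator (fun _ => 1), hU.continuous_indicator continuous_const⟩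
  have h1 : ∀ x ∈ U, m.π x z = 1 := fun x hx => by rw [hzx]; simp [hx]
  have h0 : ∀ x ∉ U, m.π x z = 0 := fun x hx => by rw [hzx]; simp [hx]
  refine ⟨z, ⟨⟨?_, ?_⟩, hz⟩, h1, h0⟩
  · apply m.ext'; intro x; rw [map_star]
    by_cases hx : x ∈ U
    · simp [h1 x hx]
    · simp [h0 x hx]
  · apply m.ext'; intro x; rw [map_mul]
    by_cases hx : x ∈ U
    · simp [h1 x hx]
    · simp [h0 x hx]

theorem supp_clopen {p : A} (hp : IsProjection p) : IsClopen {x | m.rk p x ≠ 0} := by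
  have : IsClopen ((m.rk p) ⁻¹' {0}ᶜ) := (isClopen_discrete _).preimage (m.rk_cont hp)
  exact this

end AWModel

namespace AWModel

variable {A : Type u} [CStarAlgebra A] {n : ℕ} (m : AWModel A n)

theorem scalar_of_trivial (hAW : IsAWStarRing A) (M : StarSubalgebra ℂ A)
    (hM : IsMaximalAbelian M) {g : A} (hgM : g ∈ M) (hg : IsProjection g) (x : m.X)
    (htriv : ∀ h ∈ M, IsProjection h → h * g = h → m.π x h = 0 ∨ m.π x h = m.π x g)
    (b : A) (hb : b ∈ M) (hbs : IsSelfAdjoint b) :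
    ∃ r : ℝ, m.π x (g * b) = (r : ℂ) • m.π x g := by
  let P : ℝ → A := fun r => cfc (fun t : ℝ => max (t - r) 0) b
  let Q : ℝ → A := fun r => cfc (fun t : ℝ => max (r - t) 0) b
  have hPQ : ∀ r, P r * Q r = 0 := by
    intro r
    simp only [P, Q]
    rw [← cfc_mul _ _ b (by fun_prop) (by fun_prop)]
    rw [← cfc_zero (R := ℝ) (a := b)]
    apply cfc_congr
    intro t _
    rcases le_total t r with h | h
    · simp [h]
    · simp [h]
  have hPmQ : ∀ r : ℝ, P r - Q r = b - algebraMap ℝ A r := by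
    intro r
    simp only [P, Q]
    rw [← cfc_sub _ _ b (by fun_prop) (by fun_prop)]
    have h2 : b - algebraMap ℝ A r = cfc (fun t : ℝ => t - r) b := by
      rw [cfc_sub (fun t : ℝ => t) (fun _ => r) b (by fun_prop) (by fun_prop), cfc_id' ℝ b,
        cfc_const r b]
    rw [h2]
    apply cfc_congr
    intro t _
    rcases le_total t r with h | h
    · simp [h]
    · simp [h]
  have hPM : ∀ r, P r ∈ M := by
    intro r
    apply masa_mem M hM
    intro a ha
    have hc : Commute b a := hM.1 b hb a ha
    exact (hc.cfc_real _).eq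
  have hQM : ∀ r, Q r ∈ M := by
    intro r
    apply masa_mem M hM
    intro a ha
    have hc : Commute b a := hM.1 b hb a ha
    exact (hc.cfc_real _).eq
  have hPc : Continuous P := by
    apply LipschitzWith.continuous (K := 1)
    apply LipschitzWith.of_dist_le_mul
    intro r s
    simp only [P, dist_eq_norm]
    rw [← cfc_sub _ _ b (by fun_prop) (by fun_prop)]
    apply norm_cfc_le (by positivity)
    intro t _
    simp only [NNReal.coe_one, one_mul, Real.norm_eq_abs]
    refine (abs_max_sub_max_le_abs _ _ _).trans ?_
    rw [abs_sub_comm r s]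
    exact le_of_eq (congrArg _ (by ring))
  have hQc : Continuous Q := by
    apply LipschitzWith.continuous (K := 1)
    apply LipschitzWith.of_dist_le_mul
    intro r s
    simp only [Q, dist_eq_norm]
    rw [← cfc_sub _ _ b (by fun_prop) (by fun_prop)]
    apply norm_cfc_le (by positivity)
    intro t _
    simp only [NNReal.coe_one, one_mul, Real.norm_eq_abs]
    refine (abs_max_sub_max_le_abs _ _ _).trans ?_
    exact le_of_eq (congrArg _ (by ring))
  have hspec : ∀ t ∈ spectrum ℝ b, |t| ≤ ‖b‖ * ‖(1 : A)‖ := fun t ht => by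
    have := spectrum.norm_le_norm_mul_of_mem ht
    simpa using this
  have hP0 : ∃ r, P r = 0 := by
    refine ⟨‖b‖ * ‖(1 : A)‖, ?_⟩
    simp only [P]
    rw [← cfc_zero (R := ℝ) (a := b)]
    apply cfc_congr
    intro t ht
    have := (abs_le.1 (hspec t ht)).2
    simp [this]
  have hQ0 : ∃ r, Q r = 0 := by
    refine ⟨-(‖b‖ * ‖(1 : A)‖), ?_⟩
    simp only [Q]
    rw [← cfc_zero (R := ℝ) (a := b)]
    apply cfc_congr
    intro t ht
    have := (abs_le.1 (hspec t ht)).1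
    simp only [Pi.zero_apply, max_eq_right_iff]; linarith
  have hdich : ∀ r, m.π x (g * P r) = 0 ∨ m.π x (g * Q r) = 0 := by
    intro r
    obtain ⟨h, hh, h1, h2, h3⟩ := awsup hAW {P r} (M : Set A) (fun _ h => star_mem h) (by
      rintro s rfl a ha; exact hM.1 _ (hPM r) a ha)
    have hhM : h ∈ M := masa_mem M hM h h3
    have hP := h1 _ rfl
    have hQ : h * Q r = 0 := h2 _ (by rintro s rfl; exact hPQ r)
    have hgh : g * h = h * g := hM.1 g hgM h hhM
    have hpr : IsProjection (g * h) := by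
      refine ⟨by rw [star_mul, hg.1, hh.1, hgh], ?_⟩
      calc g * h * (g * h) = g * (h * g) * h := by noncomm_ring
        _ = (g * g) * (h * h) := by rw [← hgh]; noncomm_ring
        _ = _ := by rw [hg.2, hh.2]
    rcases htriv (g * h) (mul_mem hgM hhM) hpr (by rw [mul_assoc, ← hgh, ← mul_assoc, hg.2]) with h4 | h4
    · left
      have : g * P r = g * h * P r := by
        rw [mul_assoc, hM.1 h hhM _ (hPM r), hP]
      rw [this, map_mul, h4, zero_mul]
    · right
      rw [map_mul, ← h4, ← map_mul, mul_assoc, hQ, mul_zero, map_zero]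
  have hcl : ∀ F : ℝ → A, Continuous F → IsClosed {r | m.π x (g * F r) = 0} := by
    intro F hF
    have : {r | m.π x (g * F r) = 0} = ⋂ i, ⋂ j, {r | m.π x (g * F r) i j = 0} := by
      ext r
      simp only [Set.mem_ofPred_eq, Set.mem_iInter]
      constructor
      · intro h i j; rw [h]; rfl
      · intro h; ext i j; exact h i j
    rw [this]
    refine isClosed_iInter fun i => isClosed_iInter fun j => ?_
    exact isClosed_eq ((m.cont' x i j).comp (continuous_const.mul hF)) continuous_const
  obtain ⟨p, hp⟩ := hP0
  obtain ⟨q, hq⟩ := hQ0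
  obtain ⟨r, -, hr1, hr2⟩ := isPreconnected_closed_iff.1 (isPreconnected_univ (α := ℝ)) _ _
    (hcl P hPc) (hcl Q hQc) (fun r _ => hdich r) ⟨p, trivial, by simp [hp]⟩ ⟨q, trivial, by simp [hq]⟩
  refine ⟨r, ?_⟩
  have h1 : m.π x (g * (b - algebraMap ℝ A r)) = 0 := by
    rw [← hPmQ, mul_sub, map_sub, hr1, hr2, sub_zero]
  rw [mul_sub, map_sub, sub_eq_zero] at h1
  rw [h1]
  have : algebraMap ℝ A r = algebraMap ℂ A r := by
    rw [IsScalarTower.algebraMap_apply ℝ ℂ A]; rfl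
  rw [this, map_mul, AlgHomClass.commutes, ← Algebra.commutes, ← Algebra.smul_def]

theorem abelian_of_trivial (hAW : IsAWStarRing A) (M : StarSubalgebra ℂ A)
    (hM : IsMaximalAbelian M) {g : A} (hgM : g ∈ M) (hg : IsProjection g)
    (htriv : ∀ x, ∀ h ∈ M, IsProjection h → h * g = h → m.π x h = 0 ∨ m.π x h = m.π x g) :
    IsAbelianProj g := by
  have hsa : ∀ a, ∀ b ∈ M, IsSelfAdjoint b → (g * a * g) * b = b * (g * a * g) := by
    intro a b hb hbs
    have hgb : g * b = b * g := hM.1 g hgM b hb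
    apply m.ext'
    intro x
    obtain ⟨r, hr⟩ := m.scalar_of_trivial hAW M hM hgM hg x (htriv x) b hb hbs
    have e1 : g * a * g * b = g * a * (g * b) := by noncomm_ring
    have e2 : b * (g * a * g) = (g * b) * (a * g) := by rw [hgb]; noncomm_ring
    rw [e1, e2, map_mul, map_mul _ (g * b), hr]
    simp [map_mul, mul_assoc]
  have hmem : ∀ a, g * a * g ∈ M := by
    intro a
    apply masa_mem M hM
    intro b hb
    have h1 : (realPart b : A) ∈ M := by
      rw [realPart_apply_coe]
      exact M.toSubalgebra.toSubmodule.restrictScalars ℝ |>.smul_mem _ (show b + star b ∈ M from add_mem hb (star_mem hb))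
    have h2 : (imaginaryPart b : A) ∈ M := by
      rw [imaginaryPart_apply_coe]
      exact M.smul_mem (M.toSubalgebra.toSubmodule.restrictScalars ℝ |>.smul_mem _ (show b - star b ∈ M from sub_mem hb (star_mem hb))) _
    rw [← realPart_add_I_smul_imaginaryPart b, mul_add, add_mul, hsa a _ h1 (realPart b).2,
      mul_smul_comm, smul_mul_assoc, hsa a _ h2 (imaginaryPart b).2]
  exact ⟨hg, fun a b => hM.1 _ (hmem a) _ (hmem b)⟩

theorem central_mem (M : StarSubalgebra ℂ A) (hM : IsMaximalAbelian M) {z : A}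
    (hz : IsCentralProj z) : z ∈ M := masa_mem M hM z fun b _ => hz.2 b

theorem central_mul {z g : A} (hz : IsCentralProj z) (hg : IsProjection g) :
    IsProjection (z * g) := by
  refine ⟨by rw [star_mul, hg.1, hz.1.1, hz.2], ?_⟩
  calc z * g * (z * g) = z * (g * z) * g := by noncomm_ring
    _ = (z * z) * (g * g) := by rw [← hz.2]; noncomm_ring
    _ = _ := by rw [hg.2, hz.1.2]

theorem exists_abelian (hAW : IsAWStarRing A) (M : StarSubalgebra ℂ A)
    (hM : IsMaximalAbelian M) (N : ℕ) : ∀ g ∈ M, IsProjection g → g ≠ 0 →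
    (∀ x, m.rk g x ≤ N) → ∃ e ∈ M, IsAbelianProj e ∧ e * g = e ∧ e ≠ 0 := by
  induction N with
  | zero =>
    intro g _ hg hg0 hr
    exact absurd (m.inj g fun x => (m.rk_zero hg x).1 (Nat.le_zero.1 (hr x))) hg0
  | succ N ih =>
    intro g hgM hg hg0 hr
    by_cases htriv : ∀ x, ∀ h ∈ M, IsProjection h → h * g = h → m.π x h = 0 ∨ m.π x h = m.π x g
    · exact ⟨g, hgM, m.abelian_of_trivial hAW M hM hgM hg htriv, hg.2, hg0⟩
    · push Not at htriv
      obtain ⟨x0, h, hhM, hh, hhg, hx1, hx2⟩ := htriv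
      have hU : IsClopen {x | m.rk h x < m.rk g x} := by
        have : IsClopen ((fun x => (m.rk h x, m.rk g x)) ⁻¹' {p : ℕ × ℕ | p.1 < p.2}) :=
          (isClopen_discrete _).preimage ((m.rk_cont hh).prodMk (m.rk_cont hg))
        exact this
      have hx0U : x0 ∈ {x | m.rk h x < m.rk g x} := by
        obtain ⟨h1, h2⟩ := m.rk_sub hg hh hhg x0
        have h3 : m.rk (g - h) x0 ≠ 0 := by
          intro h4
          rw [m.rk_zero h1, map_sub, sub_eq_zero] at h4
          exact hx2 h4.symm
        simp only [Set.mem_ofPred_eq]; omega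
      obtain ⟨z, hz, hz1, hz0⟩ := m.ind hU
      obtain ⟨e, heM, hea, hez, he0⟩ := ih (z * h) (mul_mem (central_mem M hM hz) hhM)
        (central_mul hz hh) (by
          intro h0
          have := congrArg (m.π x0) h0
          rw [map_mul, hz1 x0 hx0U, one_mul, map_zero] at this
          exact hx1 this) (by
          intro x
          by_cases hx : x ∈ {x | m.rk h x < m.rk g x}
          · have : m.rk (z * h) x = m.rk h x := by simp [rk, hz1 x hx]
            have h5 := hr x
            have h6 : m.rk h x < m.rk g x := hx
            omega
          · have : m.rk (z * h) x = 0 := by simp [rk, hz0 x hx]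
            omega)
      refine ⟨e, heM, hea, ?_, he0⟩
      rw [← hez, mul_assoc, mul_assoc, hhg]

theorem exists_full (hAW : IsAWStarRing A) (M : StarSubalgebra ℂ A)
    (hM : IsMaximalAbelian M) {g : A} (hgM : g ∈ M) (hg : IsProjection g)
    (hfull : ∀ x, m.π x g ≠ 0) :
    ∃ e ∈ M, IsAbelianProj e ∧ e * g = e ∧ ∀ x, m.π x e ≠ 0 := by
  let F : Set (Set A) := {S | (∀ s ∈ S, s ∈ M ∧ IsAbelianProj s ∧ s * g = s) ∧
    ∀ s ∈ S, ∀ t ∈ S, s ≠ t → ∀ a, s * a * t = 0}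
  obtain ⟨S, hS⟩ := zorn_subset F (by
    intro c hc hch
    refine ⟨⋃₀ c, ⟨?_, ?_⟩, fun s hs => Set.subset_sUnion_of_mem hs⟩
    · rintro s ⟨C, hC, hs⟩; exact (hc hC).1 s hs
    · rintro s ⟨C, hC, hs⟩ t ⟨D, hD, ht⟩
      rcases hch.total hC hD with h | h
      · exact (hc hD).2 s (h hs) t ht
      · exact (hc hC).2 s hs t (h ht))
  obtain ⟨⟨hS1, hS2⟩, hmax⟩ := hS
  obtain ⟨e, he, h1, h2, h3⟩ := awsup hAW S (M : Set A) (fun _ h => star_mem h)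
    (fun s hs a ha => hM.1 s (hS1 s hs).1 a ha)
  have heM : e ∈ M := masa_mem M hM e h3
  have hes : ∀ s ∈ S, e * s = s := fun s hs => by
    have := congrArg star (h1 s hs)
    rwa [star_mul, he.1, (hS1 s hs).2.1.1.1] at this
  have heg : e * g = e := by
    have := h2 (1 - g) (fun s hs => by rw [mul_sub, (hS1 s hs).2.2]; simp)
    rw [mul_sub, mul_one, sub_eq_zero] at this
    exact this.symm
  have hsae : ∀ s ∈ S, ∀ a, s * a * e = s * a * s := by
    intro s hs a
    have hss := (hS1 s hs).2.1.1
    have : e * ((e - s) * star a * s) = 0 := by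
      apply h2
      intro t ht
      by_cases hts : t = s
      · subst hts
        have : t * (e - t) = 0 := by rw [mul_sub, h1 t ht, hss.2, sub_self]
        rw [← mul_assoc, ← mul_assoc, this]; simp
      · have h4 := hS2 t ht s hs hts (star a)
        have h5 : t * s = 0 := by simpa using hS2 t ht s hs hts 1
        have : t * (e - s) = t := by rw [mul_sub, h1 t ht, h5, sub_zero]
        rw [← mul_assoc, ← mul_assoc, this, h4]
    have h6 : e * (e - s) = e - s := by rw [mul_sub, he.2, hes s hs]
    rw [← mul_assoc, ← mul_assoc, h6] at this
    have h7 := congrArg star this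
    simp only [star_mul, star_sub, star_star, he.1, hss.1, star_zero] at h7
    rw [← mul_assoc, mul_sub, sub_eq_zero] at h7
    exact h7
  have hea : IsAbelianProj e := by
    refine ⟨he, fun a b => ?_⟩
    rw [← sub_eq_zero]
    set y := e * a * e * (e * b * e) - e * b * e * (e * a * e) with hy
    have hey : e * y = y := by
      rw [hy, mul_sub]; simp only [← mul_assoc, he.2]
    rw [← hey]
    apply h2
    intro s hs
    have hss := (hS1 s hs).2.1
    have k : ∀ a b, s * (e * a * e * (e * b * e)) = s * a * s * (s * b * s) := by
      intro a b
      calc s * (e * a * e * (e * b * e)) = (s * e) * a * (e * e) * b * e := by noncomm_ring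
        _ = (s * a * e) * b * e := by rw [h1 s hs, he.2]
        _ = (s * a) * (s * b * e) := by rw [hsae s hs]; noncomm_ring
        _ = (s * a) * (s * s * b * s) := by rw [hsae s hs, hss.1.2]
        _ = _ := by noncomm_ring
    rw [hy, mul_sub, k, k, hss.2, sub_self]
  refine ⟨e, heM, hea, heg, ?_⟩
  intro x hx
  have hU := (m.supp_clopen he).compl
  obtain ⟨z, hz, hz1, hz0⟩ := m.ind hU
  have hxU : x ∈ {x | m.rk e x ≠ 0}ᶜ := by simp [m.rk_zero he, hx]
  have hze : z * e = 0 := by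
    apply m.inj
    intro y
    by_cases hy : y ∈ {x | m.rk e x ≠ 0}ᶜ
    · have : m.π y e = 0 := by
        rw [← m.rk_zero he]; simpa using hy
      rw [map_mul, this, mul_zero]
    · rw [map_mul, hz0 y hy, zero_mul]
  obtain ⟨e', he'M, he'a, he'z, he'0⟩ := m.exists_abelian hAW M hM n (z * g)
    (mul_mem (central_mem M hM hz) hgM) (central_mul hz hg) (by
      intro h0
      have := congrArg (m.π x) h0
      rw [map_mul, hz1 x hxU, one_mul, map_zero] at this
      exact hfull x this) (fun y => Matrix.rank_le_height _)
  have hzs : ∀ s ∈ S, z * s = 0 := by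
    intro s hs
    rw [← hes s hs, ← mul_assoc, hze, zero_mul]
  have he'z1 : e' * z = e' := by
    nth_rw 1 [← he'z]
    rw [mul_assoc, mul_assoc, ← hz.2 g, ← mul_assoc z, hz.1.2, he'z]
  have he's : ∀ s ∈ S, ∀ a, e' * a * s = 0 := by
    intro s hs a
    rw [← he'z1, mul_assoc e', hz.2 a, mul_assoc, mul_assoc, hzs s hs]; simp
  have hins : insert e' S ∈ F := by
    refine ⟨?_, ?_⟩
    · rintro s (rfl | hs)
      · exact ⟨he'M, he'a, by nth_rw 1 [← he'z]; rw [mul_assoc, mul_assoc, hg.2, he'z]⟩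
      · exact hS1 s hs
    · rintro s (rfl | hs) t (rfl | ht) hst a
      · exact absurd rfl hst
      · exact he's t ht a
      · have := congrArg star (he's s hs (star a))
        simpa [star_mul, he'a.1.1, (hS1 s hs).2.1.1.1, mul_assoc] using this
      · exact hS2 s hs t ht hst a
  have he'S : e' ∈ S := hmax hins (Set.subset_insert _ _) (Set.mem_insert _ _)
  apply he'0
  rw [← he'z1, ← hz.2, hzs e' he'S]

end AWModel

theorem mat_mul_single_mul {n : ℕ} (P Q : Matrix (Fin n) (Fin n) ℂ) (i j a b : Fin n) :
    (P * Matrix.single i j (1 : ℂ) * Q : Matrix (Fin n) (Fin n) ℂ) a b = P a i * Q j b := by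
  rw [Matrix.mul_apply, Finset.sum_eq_single j]
  · simp
  · intro k _ hk; simp [Matrix.mul_single_apply_of_ne, hk]
  · simp

namespace AWModel

variable {A : Type u} [CStarAlgebra A] {n : ℕ} (m : AWModel A n)

theorem abelian_entries {e : A} (he : IsAbelianProj e) (x : m.X) (i j k l a b : Fin n) :
    m.π x e a i * m.π x e j k * m.π x e l b = m.π x e a k * m.π x e l i * m.π x e j b := by
  have h := congrArg (m.π x) (he.2 (m.E i j) (m.E k l))
  simp only [map_mul, m.units] at h
  have hP := m.proj_sq he.1 x
  set P := m.π x e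
  have key : ∀ i j k l : Fin n, (P * Matrix.single i j (1 : ℂ) * P * (P * Matrix.single k l (1 : ℂ) * P) : Matrix (Fin n) (Fin n) ℂ) a b
      = P a i * P j k * P l b := by
    intro i j k l
    have : P * Matrix.single i j 1 * P * (P * Matrix.single k l 1 * P)
        = P * Matrix.single i j 1 * (P * Matrix.single k l 1 * P) := by
      simp only [mul_assoc]; rw [← mul_assoc P P, hP]
    rw [this, mat_mul_single_mul, mat_mul_single_mul, mul_assoc]
  have h2 := congrFun (congrFun h a) b
  rw [key, key] at h2
  exact h2

theorem abelian_entries2 {e : A} (he : IsAbelianProj e) (x : m.X) (j k l b : Fin n) :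
    (m.rk e x : ℂ) * (m.π x e j k * m.π x e l b) = m.π x e l k * m.π x e j b := by
  have hP := m.proj_sq he.1 x
  rw [← m.rk_trace he.1 x, Matrix.trace, Finset.sum_mul]
  simp only [Matrix.diag]
  have : ∀ i, m.π x e i i * (m.π x e j k * m.π x e l b) =
      (m.π x e l i * m.π x e i k) * m.π x e j b := by
    intro i
    rw [← mul_assoc, m.abelian_entries he x i j k l i b]; ring
  simp only [this, ← Finset.sum_mul]
  rw [← Matrix.mul_apply, hP]

theorem abelian_rk_one {e : A} (he : IsAbelianProj e) (x : m.X) (h0 : m.π x e ≠ 0) :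
    m.rk e x = 1 := by
  have hP := m.proj_sq he.1 x
  have hr0 : m.rk e x ≠ 0 := by rwa [Ne, m.rk_zero he.1]
  have h1 : (m.rk e x : ℂ) * ((m.rk e x : ℂ) * (m.rk e x : ℂ)) = m.rk e x := by
    have : (m.rk e x : ℂ) * (m.rk e x : ℂ) = ∑ j, ∑ l, m.π x e j j * m.π x e l l := by
      rw [← m.rk_trace he.1 x, Matrix.trace, Finset.sum_mul_sum]; rfl
    rw [this]
    simp only [Finset.mul_sum, m.abelian_entries2 he x]
    rw [← m.rk_trace he.1 x]
    nth_rw 3 [← hP]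
    rw [Finset.sum_comm]
    simp only [Matrix.trace, Matrix.diag, Matrix.mul_apply]
  have h2 : m.rk e x * (m.rk e x * m.rk e x) = m.rk e x := by exact_mod_cast h1
  have h3 : m.rk e x * m.rk e x = 1 := by
    apply Nat.eq_of_mul_eq_mul_left (Nat.pos_of_ne_zero hr0)
    rw [h2, mul_one]
  exact Nat.eq_one_of_mul_eq_one_left h3

theorem central_cover {e : A} (hfull : ∀ x, m.π x e ≠ 0) : IsCentralCover e 1 := by
  refine ⟨⟨⟨by simp, by simp⟩, by simp⟩, by simp [ProjLE], fun z hz hez => ?_⟩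
  rw [ProjLE, one_mul]
  rw [ProjLE] at hez
  apply m.ext'
  intro x
  have hzc : ∀ i j, m.π x z * Matrix.single i j 1 = Matrix.single i j 1 * m.π x z := by
    intro i j
    rw [← m.units, ← map_mul, hz.2, map_mul]
  obtain ⟨a, b, hab⟩ : ∃ a b, m.π x e a b ≠ 0 := by
    by_contra h; push Not at h
    exact hfull x (by ext i j; exact h i j)
  have hmul : m.π x e * m.π x z = m.π x e := by rw [← map_mul, hez]
  have hmul2 : m.π x z * m.π x e = m.π x e := by rw [← map_mul, hz.2, hez]
  rw [map_one]
  ext i j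
  have h1 := mat_mul_single_mul (m.π x z) (m.π x e) j a i b
  rw [hzc, mul_assoc, hmul2] at h1
  have h2 := mat_mul_single_mul 1 (m.π x e) j a i b
  rw [one_mul, h1] at h2
  exact mul_right_cancel₀ hab h2

theorem sep (hAW : IsAWStarRing A) (i0 : Fin n) (t : m.X → ℝ) (ht : Continuous t) (c : ℝ) :
    ∃ U : Set m.X, IsClopen U ∧ (∀ x ∈ U, c ≤ t x) ∧ ∀ x ∉ U, t x ≤ c := by
  obtain ⟨p, hp, hpx⟩ := m.lift ⟨fun x => ((max (t x - c) 0 : ℝ) : ℂ), by fun_prop⟩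
  obtain ⟨q, hq, hqx⟩ := m.lift ⟨fun x => ((max (c - t x) 0 : ℝ) : ℂ), by fun_prop⟩
  obtain ⟨h, hh, h1, h2, -⟩ := awsup hAW {p} ∅ (by simp) (by simp)
  have hpq : p * q = 0 := by
    apply m.inj
    intro x
    rw [map_mul, hpx, hqx]
    rcases le_total (t x) c with h | h
    · simp [h]
    · simp [h]
  have hph := h1 p rfl
  have hhq : h * q = 0 := h2 q (by rintro s rfl; exact hpq)
  refine ⟨_, m.supp_clopen hh, ?_, ?_⟩
  · intro x hx
    have hx' : m.π x h ≠ 0 := fun h0 => hx ((m.rk_zero hh x).2 h0)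
    have := congrArg (m.π x) hhq
    rw [map_mul, hqx, map_zero, mul_smul_comm, mul_one, smul_eq_zero] at this
    have h3 := this.resolve_right hx'
    simp only [ContinuousMap.coe_mk, Complex.ofReal_eq_zero, max_eq_right_iff] at h3
    linarith
  · intro x hx
    have hx' : m.π x h = 0 := by rw [← m.rk_zero hh x]; simpa using hx
    by_contra hlt
    push Not at hlt
    have := congrArg (m.π x) hph
    rw [map_mul, hx', mul_zero, hpx] at this
    have h3 : ((max (t x - c) 0 : ℝ) : ℂ) ≠ 0 := by
      rw [Ne, Complex.ofReal_eq_zero, max_eq_right_iff]; linarith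
    have h4 : (1 : Matrix (Fin n) (Fin n) ℂ) = 0 := (smul_eq_zero.1 this.symm).resolve_left h3
    simpa using congrFun (congrFun h4 i0) i0

theorem equiv_unit (hAW : IsAWStarRing A) (i0 : Fin n) {e : A} (he : IsAbelianProj e)
    (hfull : ∀ x, m.π x e ≠ 0) : ∃ w, star w * w = m.E i0 i0 ∧ w * star w = e := by
  have hn : 0 < n := i0.pos
  let c : ℝ := 1 / (2 * n)
  have hc : 0 < c := by positivity
  let t : Fin n → m.X → ℝ := fun j x => (m.π x e j j).re
  have ht : ∀ j, Continuous (t j) := fun j => Complex.continuous_re.comp (m.cont e j j)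
  choose U hU1 hU2 hU3 using fun j => m.sep hAW i0 (t j) (ht j) c
  have hcov : ∀ x, ∃ j, x ∈ U j := by
    intro x
    by_contra hcon
    push Not at hcon
    have h1 : ∑ j, t j x = 1 := by
      have := m.rk_trace he.1 x
      rw [m.abelian_rk_one he x (hfull x)] at this
      have := congrArg Complex.re this
      simpa [Matrix.trace, t] using this
    have h2 : ∑ j, t j x ≤ ∑ j : Fin n, c := Finset.sum_le_sum fun j _ => hU3 j x (hcon j)
    rw [h1] at h2
    have hn' : (n : ℝ) ≠ 0 := by positivity
    have h3 : ∑ j : Fin n, c = 1 / 2 := by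
      simp [c]; field_simp
    rw [h3] at h2
    norm_num at h2
  let V : Fin n → Set m.X := fun j => U j ∩ ⋂ i : {i // i < j}, (U i)ᶜ
  have hV : ∀ j, IsClopen (V j) := fun j =>
    (hU1 j).inter (isClopen_iInter_of_finite fun i => (hU1 i).compl)
  have hVex : ∀ x, ∃ j, x ∈ V j ∧ ∀ k, k ≠ j → x ∉ V k := by
    intro x
    obtain ⟨j, hj, hmin⟩ := WellFounded.has_min (wellFounded_lt (α := Fin n)) {j | x ∈ U j} (hcov x)
    have hjV : x ∈ V j := ⟨hj, Set.mem_iInter.2 fun i hi => hmin i hi i.2⟩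
    refine ⟨j, hjV, fun k hk hkV => ?_⟩
    rcases lt_or_gt_of_ne hk with h | h
    · exact hmin k hkV.1 h
    · exact Set.mem_iInter.1 hkV.2 ⟨j, h⟩ hj
  let d : Fin n → C(m.X, ℂ) := fun j =>
    ⟨(V j).indicator fun x => (((Real.sqrt (max (t j x) c))⁻¹ : ℝ) : ℂ), by
      apply (hV j).continuous_indicator
      have := ht j
      apply Complex.continuous_ofReal.comp
      apply Continuous.inv₀
      · fun_prop
      · intro x
        have : 0 < max (t j x) c := lt_max_of_lt_right hc
        positivity⟩
  choose z hz hzx using fun j => m.lift (d j)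
  let w : A := ∑ j, e * m.E j i0 * z j
  have hw : ∀ x, ∃ j, ∃ r : ℝ, (r : ℂ) * r * m.π x e j j = 1 ∧
      m.π x w = (r : ℂ) • (m.π x e * Matrix.single j i0 1) := by
    intro x
    obtain ⟨j, hj, hk⟩ := hVex x
    have htj : c ≤ t j x := hU2 j x hj.1
    have hpos : 0 < t j x := lt_of_lt_of_le hc htj
    refine ⟨j, (Real.sqrt (t j x))⁻¹, ?_, ?_⟩
    · have him : m.π x e j j = (t j x : ℂ) := by
        have h1 : star (m.π x e) = m.π x e := by rw [← map_star, he.1.1]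
        have h2 := congrFun (congrFun h1 j) j
        rw [Matrix.star_apply] at h2
        exact (Complex.conj_eq_iff_re.1 h2).symm
      rw [him]
      norm_cast
      have := Real.mul_self_sqrt hpos.le
      have h3 : Real.sqrt (t j x) ≠ 0 := by positivity
      rw [← mul_inv, this, inv_mul_cancel₀ hpos.ne']
    · simp only [w, map_sum, map_mul, m.units, hzx]
      rw [Finset.sum_eq_single j]
      · simp [d, hj, max_eq_left htj]
      · intro k _ hkj; simp [d, hk k hkj]
      · simp
  refine ⟨w, ?_, ?_⟩
  · apply m.ext'
    intro x
    obtain ⟨j, r, hr, hwx⟩ := hw x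
    have hP := m.proj_sq he.1 x
    have h1 : star (m.π x e) = m.π x e := by rw [← map_star, he.1.1]
    rw [map_mul, map_star, hwx, m.units]
    set P := m.π x e
    have h2 : star (Matrix.single j i0 (1 : ℂ)) = Matrix.single i0 j 1 := by
      rw [Matrix.star_eq_conjTranspose, Matrix.conjTranspose_single]; simp
    rw [star_smul, star_mul, h1, h2, smul_mul_smul_comm]
    have h3 : Matrix.single i0 j 1 * P * (P * Matrix.single j i0 1) =
        P j j • Matrix.single i0 i0 (1 : ℂ) := by
      rw [mul_assoc, ← mul_assoc P P, hP, ← mul_assoc]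
      ext a b
      simp [Matrix.single_mul_mul_single, Matrix.single_apply]
    rw [h3, smul_smul]
    simp only [Complex.star_def, Complex.conj_ofReal, hr, one_smul]
  · apply m.ext'
    intro x
    obtain ⟨j, r, hr, hwx⟩ := hw x
    have hP := m.proj_sq he.1 x
    have h1 : star (m.π x e) = m.π x e := by rw [← map_star, he.1.1]
    have hent := m.abelian_entries2 he x
    rw [m.abelian_rk_one he x (hfull x)] at hent
    rw [map_mul, map_star, hwx]
    set P := m.π x e
    have h2 : star (Matrix.single j i0 (1 : ℂ)) = Matrix.single i0 j 1 := by
      rw [Matrix.star_eq_conjTranspose, Matrix.conjTranspose_single]; simp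
    rw [star_smul, star_mul, h1, h2, smul_mul_smul_comm]
    have h3 : P * Matrix.single j i0 1 * (Matrix.single i0 j 1 * P) = P j j • P := by
      rw [← mul_assoc, mul_assoc P, Matrix.single_mul_single_same, mul_one]
      ext a b
      rw [mat_mul_single_mul, Matrix.smul_apply, smul_eq_mul]
      have := hent j j a b
      rw [← this]; simp
    rw [h3, smul_smul]
    simp only [Complex.star_def, Complex.conj_ofReal, hr, one_smul]

theorem exists_family (hAW : IsAWStarRing A) (M : StarSubalgebra ℂ A)
    (hM : IsMaximalAbelian M) (k : ℕ) (hk : k ≤ n) :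
    ∃ e : Fin k → A, (∀ i, e i ∈ M) ∧ (∀ i, IsAbelianProj (e i)) ∧
      (∀ i x, m.π x (e i) ≠ 0) ∧ PairwiseOrthogonal e ∧ IsProjection (1 - ∑ i, e i) ∧
      ∀ x, m.rk (1 - ∑ i, e i) x = n - k := by
  induction k with
  | zero =>
    refine ⟨Fin.elim0, fun i => i.elim0, fun i => i.elim0, fun i => i.elim0, fun i => i.elim0, ?_, ?_⟩
    · simp [IsProjection]
    · intro x; simp [rk, Matrix.rank_one]
  | succ k ih =>
    obtain ⟨e, h1, h2, h3, h4, h5, h6⟩ := ih (by omega)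
    set g := 1 - ∑ i, e i with hg
    have hgM : g ∈ M := sub_mem (one_mem M) (sum_mem fun i _ => h1 i)
    obtain ⟨f, hfM, hfa, hfg, hff⟩ := m.exists_full hAW M hM hgM h5 (by
      intro x hx
      rw [← m.rk_zero h5, h6] at hx
      omega)
    have hei : ∀ i, g * e i = 0 := by
      intro i
      rw [hg, sub_mul, one_mul, Finset.sum_mul, Finset.sum_eq_single i, (h2 i).1.2, sub_self]
      · intro j _ hj; exact h4 j i hj
      · simp
    have hfe : ∀ i, f * e i = 0 := fun i => by rw [← hfg, mul_assoc, hei, mul_zero]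
    have hef : ∀ i, e i * f = 0 := fun i => by rw [hM.1 _ (h1 i) _ hfM, hfe]
    have hsum : 1 - ∑ i, (Fin.snoc e f : Fin (k + 1) → A) i = g - f := by
      rw [Fin.sum_univ_castSucc]
      simp only [Fin.snoc_castSucc, Fin.snoc_last, hg]; abel
    refine ⟨Fin.snoc e f, ?_, ?_, ?_, ?_, ?_, ?_⟩
    · intro i; refine Fin.lastCases ?_ (fun j => ?_) i
      · simpa using hfM
      · simpa using h1 j
    · intro i; refine Fin.lastCases ?_ (fun j => ?_) i
      · simpa using hfa
      · simpa using h2 j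
    · intro i x; refine Fin.lastCases ?_ (fun j => ?_) i
      · simpa using hff x
      · simpa using h3 j x
    · intro i j
      refine Fin.lastCases ?_ (fun j => ?_) j <;> refine Fin.lastCases ?_ (fun i => ?_) i
      · simp
      · intro _; simpa using hef i
      · intro _; simpa using hfe j
      · intro hij; simpa using h4 i j (fun h => hij (by rw [h]))
    · have : g - f = g - f := rfl
      rw [hsum]
      have hfg' : g * f = f := by rw [hM.1 _ hgM _ hfM, hfg]
      exact ⟨by simp [h5.1, hfa.1.1], by simp [mul_sub, sub_mul, h5.2, hfa.1.2, hfg, hfg']⟩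
    · intro x
      rw [hsum]
      have h7 := (m.rk_sub h5 hfa.1 hfg x).2
      rw [m.abelian_rk_one hfa x (hff x), h6] at h7
      omega

end AWModel

/-- In an AW*-algebra of type Iₙ (n finite), any maximal abelian subalgebra
contains `n` pairwise orthogonal, pairwise equivalent abelian projections, each
with central cover `1`, summing to `1`. -/
theorem typeIn_masa_abelian_projections {A : Type u} [NormedRing A] [StarRing A]
    [CStarRing A] [NormedAlgebra ℂ A] [StarModule ℂ A] [CompleteSpace A]
    (hAW : IsAWStarRing A)
    (n : ℕ) (hn : 0 < n)
    (hIn : ∃ f : Fin n → A, (∀ i, IsAbelianProj (f i)) ∧ PairwiseOrthogonal f ∧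
      (∀ i j, ProjEquiv (f i) (f j)) ∧ ∑ i, f i = 1)
    (M : StarSubalgebra ℂ A) (hM : IsMaximalAbelian M) :
    ∃ e : Fin n → A, (∀ i, e i ∈ M) ∧ (∀ i, IsAbelianProj (e i)) ∧
      (∀ i, IsCentralCover (e i) 1) ∧ PairwiseOrthogonal e ∧
      (∀ i j, ProjEquiv (e i) (e j)) ∧ ∑ i, e i = 1 := by
  obtain ⟨f, hab, horth, heq, hsum⟩ := hIn
  let _ : CStarAlgebra A := { ‹NormedRing A›, ‹StarRing A›, ‹CStarRing A›, ‹NormedAlgebra ℂ A›,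
    ‹StarModule ℂ A›, ‹CompleteSpace A› with }
  obtain ⟨m⟩ := exists_awModel n ⟨0, hn⟩ f hab horth heq hsum
  obtain ⟨e, h1, h2, h3, h4, h5, h6⟩ := m.exists_family hAW M hM n le_rfl
  refine ⟨e, h1, h2, fun i => m.central_cover (h3 i), h4, ?_, ?_⟩
  · intro i j
    obtain ⟨v, hv1, hv2⟩ := m.equiv_unit hAW ⟨0, hn⟩ (h2 i) (h3 i)
    obtain ⟨w, hw1, hw2⟩ := m.equiv_unit hAW ⟨0, hn⟩ (h2 j) (h3 j)
    refine ⟨w * star v, ?_, ?_⟩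
    · calc star (w * star v) * (w * star v) = v * (star w * w) * star v := by
            rw [star_mul, star_star]; simp only [mul_assoc]
        _ = (v * star v) * (v * star v) := by rw [hw1, ← hv1]; simp only [mul_assoc]
        _ = e i := by rw [hv2, (h2 i).1.2]
    · calc (w * star v) * star (w * star v) = w * (star v * v) * star w := by
            rw [star_mul, star_star]; simp only [mul_assoc]
        _ = (w * star w) * (w * star w) := by rw [hv1, ← hw1]; simp only [mul_assoc]
        _ = e j := by rw [hw2, (h2 j).1.2]
  · have : (1 : A) - ∑ i, e i = 0 := by
      apply m.inj
      intro x
      rw [← m.rk_zero h5, h6, Nat.sub_self]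
    exact (sub_eq_zero.1 this).symm
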